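/- Let f, g : [0,1] → ℝ be continuous nonnegative probability density functions on [0,1] with ∫₀¹ f = ∫₀¹ g = 1, with CDFs F(x) = ∫₀ˣ f and G(x) = ∫₀ˣ g. Suppose (i) there is t ∈ (0,1) with f(x) ≤ g(x) for x ∈ [0,t] and f(x) ≥ g(x) for x ∈ [t,1] (single crossing), and (ii) the function x ↦ G(x) − F(x) is concave on [0,1]. Then the generalization gap bounds the attack advantage: ∫₀¹ x·f(x) dx − ∫₀¹ x·g(x) dx ≥ (G(t) − F(t))/2. -/

import Mathlib

open MeasureTheory intervalIntegral Set

/-- Integration by parts against the primitive of a continuous function. -/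
theorem integral_id_mul_eq_sub_integral_primitive {h : ℝ → ℝ} {b : ℝ} (hb : 0 ≤ b)
    (hc : ContinuousOn h (Set.Icc 0 b)) :
    ∫ x in (0:ℝ)..b, x * h x =
      b * (∫ s in (0:ℝ)..b, h s) - ∫ x in (0:ℝ)..b, ∫ s in (0:ℝ)..x, h s := by
  have hi : IntervalIntegrable h volume 0 b := by
    apply ContinuousOn.intervalIntegrable
    rwa [uIcc_of_le hb]
  have hd : ∀ x ∈ Ioo (min 0 b) (max 0 b),
      HasDerivAt (fun x => ∫ s in (0:ℝ)..x, h s) (h x) x := by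
    intro x hx
    rw [min_eq_left hb, max_eq_right hb] at hx
    have hc' : ContinuousOn h (Ioo 0 b) := hc.mono Ioo_subset_Icc_self
    refine integral_hasDerivAt_right
      (hi.mono_set (uIcc_subset_uIcc_left ?_))
      (hc'.stronglyMeasurableAtFilter isOpen_Ioo x hx)
      (hc'.continuousAt (isOpen_Ioo.mem_nhds hx))
    rw [uIcc_of_le hb]
    exact Ioo_subset_Icc_self hx
  have key := integral_mul_deriv_eq_deriv_mul_of_hasDerivAt continuousOn_id
    (continuousOn_primitive_interval' hi left_mem_uIcc) (fun x _ => hasDerivAt_id x) hd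
    intervalIntegrable_const hi
  simpa using key

/-- The trapezoid lower bound for the integral of a concave function. -/
theorem ConcaveOn.trapezoid_le_integral {H : ℝ → ℝ} {a b : ℝ} (hab : a < b)
    (hH : ConcaveOn ℝ (Set.Icc a b) H) (hi : IntervalIntegrable H volume a b) :
    (b - a) * (H a + H b) / 2 ≤ ∫ x in a..b, H x := by
  have hba : 0 < b - a := sub_pos.2 hab
  have hlin : ∫ x in a..b, (H a + (x - a) * ((H b - H a) / (b - a))) =
      (b - a) * (H a + H b) / 2 := by
    rw [intervalIntegral.integral_add intervalIntegrable_const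
      (Continuous.intervalIntegrable (by fun_prop) _ _), intervalIntegral.integral_mul_const,
      intervalIntegral.integral_sub (Continuous.intervalIntegrable (by fun_prop) _ _)
      intervalIntegrable_const, integral_id]
    simp only [intervalIntegral.integral_const, smul_eq_mul]
    field_simp
    ring
  rw [← hlin]
  refine integral_mono_on hab.le (Continuous.intervalIntegrable (by fun_prop) _ _) hi ?_
  intro x hx
  have key := hH.2 (left_mem_Icc.2 hab.le) (right_mem_Icc.2 hab.le)
    (div_nonneg (sub_nonneg.2 hx.2) hba.le) (div_nonneg (sub_nonneg.2 hx.1) hba.le)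
    (by field_simp; ring)
  simp only [smul_eq_mul] at key
  have hx' : (b - x) / (b - a) * a + (x - a) / (b - a) * b = x := by
    field_simp
    ring
  rw [hx'] at key
  refine le_of_eq_of_le ?_ key
  field_simp
  ring

/-- Under single crossing at `t` and concavity of `G − F` on `[0,1]`,
the generalization gap bounds the attack advantage:
`∫₀¹ x·f x dx − ∫₀¹ x·g x dx ≥ (G t − F t)/2`. -/
theorem generalization_gap_ge_attack_advantage
    (f g F G : ℝ → ℝ) (t : ℝ) (ht : t ∈ Set.Ioo (0:ℝ) 1)
    (hfc : ContinuousOn f (Set.Icc 0 1)) (hgc : ContinuousOn g (Set.Icc 0 1))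
    (hf0 : ∀ x ∈ Set.Icc (0:ℝ) 1, 0 ≤ f x) (hg0 : ∀ x ∈ Set.Icc (0:ℝ) 1, 0 ≤ g x)
    (hf1 : ∫ x in (0:ℝ)..1, f x = 1) (hg1 : ∫ x in (0:ℝ)..1, g x = 1)
    (hF : ∀ x, F x = ∫ s in (0:ℝ)..x, f s) (hG : ∀ x, G x = ∫ s in (0:ℝ)..x, g s)
    (hleft : ∀ x ∈ Set.Icc (0:ℝ) t, f x ≤ g x)
    (hright : ∀ x ∈ Set.Icc t (1:ℝ), g x ≤ f x)
    (hconc : ConcaveOn ℝ (Set.Icc (0:ℝ) 1) (fun x => G x - F x)) :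
    (G t - F t) / 2 ≤ (∫ x in (0:ℝ)..1, x * f x) - ∫ x in (0:ℝ)..1, x * g x := by
  have hfi : IntervalIntegrable f volume 0 1 := by
    apply ContinuousOn.intervalIntegrable
    rwa [uIcc_of_le zero_le_one]
  have hgi : IntervalIntegrable g volume 0 1 := by
    apply ContinuousOn.intervalIntegrable
    rwa [uIcc_of_le zero_le_one]
  have hFi : IntervalIntegrable F volume 0 1 := by
    rw [funext hF]
    exact (continuousOn_primitive_interval' hfi left_mem_uIcc).intervalIntegrable
  have hGi : IntervalIntegrable G volume 0 1 := by
    rw [funext hG]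
    exact (continuousOn_primitive_interval' hgi left_mem_uIcc).intervalIntegrable
  have hgap : (∫ x in (0:ℝ)..1, x * f x) - ∫ x in (0:ℝ)..1, x * g x =
      ∫ x in (0:ℝ)..1, (G x - F x) := by
    rw [intervalIntegral.integral_sub hGi hFi,
      integral_id_mul_eq_sub_integral_primitive zero_le_one hfc,
      integral_id_mul_eq_sub_integral_primitive zero_le_one hgc, hf1, hg1]
    simp only [← hF, ← hG]
    ring
  have htm : t ∈ uIcc (0:ℝ) 1 := by
    rw [uIcc_of_le zero_le_one]
    exact Ioo_subset_Icc_self ht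
  have hi := hGi.sub hFi
  have hi₁ := hi.mono_set (uIcc_subset_uIcc_left htm)
  have hi₂ := hi.mono_set (uIcc_subset_uIcc_right htm)
  have h₁ := (hconc.subset (Icc_subset_Icc_right ht.2.le)
    (convex_Icc 0 t)).trapezoid_le_integral ht.1 hi₁
  have h₂ := (hconc.subset (Icc_subset_Icc_left ht.1.le)
    (convex_Icc t 1)).trapezoid_le_integral ht.2 hi₂
  have hsum := integral_add_adjacent_intervals hi₁ hi₂
  have hF0 : F 0 = 0 := by rw [hF, integral_same]
  have hG0 : G 0 = 0 := by rw [hG, integral_same]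
  have hF1 : F 1 = 1 := by rw [hF, hf1]
  have hG1 : G 1 = 1 := by rw [hG, hg1]
  simp only [hF0, hG0, hF1, hG1] at h₁ h₂
  rw [hgap, ← hsum]
  linarith
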